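/- arXiv:2002.09432 — 2 statements merged into one kernel-verified Lean document; each statement's English description precedes it below -/
import Mathlib

section
/- Let U be a nonnegative real n×n matrix (not necessarily nonsingular) such that both U and its transpose Uᵗ satisfy the Complete Maximum Principle. Then for every x ∈ ℝⁿ one has ⟨(Ux − 𝟙)⁺, x⟩ ≥ 0. -/
open Matrix Finset

/-- A matrix `U` satisfies the Complete Maximum Principle if, whenever `(Ux) i ≤ 1`
for all coordinates `i` with `x i ≥ 0`, then `Ux ≤ 𝟙`. -/
def SatisfiesCMP {n : ℕ} (U : Matrix (Fin n) (Fin n) ℝ) : Prop :=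
  ∀ x : Fin n → ℝ, (∀ i, 0 ≤ x i → U.mulVec x i ≤ 1) → ∀ j, U.mulVec x j ≤ 1

namespace SatisfiesCMP

variable {n : ℕ} {U M : Matrix (Fin n) (Fin n) ℝ}

/-- The Complete Maximum Principle is stable under adding a nonnegative multiple of the identity. -/
theorem add_smul_one (h : SatisfiesCMP U) {a : ℝ} (ha : 0 ≤ a) :
    SatisfiesCMP (U + a • (1 : Matrix (Fin n) (Fin n) ℝ)) := by
  intro x hx j
  simp only [add_mulVec, smul_mulVec, one_mulVec, Pi.add_apply, Pi.smul_apply,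
    smul_eq_mul] at hx ⊢
  rcases le_or_gt 0 (x j) with hj | hj
  · exact hx j hj
  · have hUx : U.mulVec x j ≤ 1 := by
      refine h x (fun i hi => ?_) j
      linarith [hx i hi, mul_nonneg ha hi]
    linarith [mul_nonneg ha (neg_nonneg.2 hj.le)]

theorem mulVec_nonpos (h : SatisfiesCMP U) {x : Fin n → ℝ}
    (hx : ∀ i, 0 ≤ x i → U.mulVec x i ≤ 0) (j : Fin n) : U.mulVec x j ≤ 0 := by
  by_contra! hj
  have key := h ((2 / U.mulVec x j) • x) (fun i hi => ?_) j
  · rw [mulVec_smul, Pi.smul_apply, smul_eq_mul, div_mul_cancel₀ _ hj.ne'] at key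
    norm_num at key
  · have hc : 0 < 2 / U.mulVec x j := by positivity
    rw [Pi.smul_apply, smul_eq_mul] at hi
    rw [mulVec_smul, Pi.smul_apply, smul_eq_mul]
    linarith [mul_nonneg hc.le (neg_nonneg.2 (hx i (nonneg_of_mul_nonneg_right hi hc)))]

theorem isUnit_add_smul_one (h : SatisfiesCMP U) {a : ℝ} (ha : 0 < a) :
    IsUnit (U + a • (1 : Matrix (Fin n) (Fin n) ℝ)) := by
  have nonneg_of_ker : ∀ x : Fin n → ℝ,
      (U + a • (1 : Matrix (Fin n) (Fin n) ℝ)).mulVec x = 0 → ∀ i, 0 ≤ x i := by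
    intro x hx i
    have hUx : ∀ k, U.mulVec x k = -(a * x k) := by
      intro k
      have := congrFun hx k
      simp only [add_mulVec, smul_mulVec, one_mulVec, Pi.add_apply, Pi.smul_apply,
        smul_eq_mul, Pi.zero_apply] at this
      linarith
    have := h.mulVec_nonpos (x := x)
      (fun k hk => by rw [hUx]; exact neg_nonpos.2 (mul_nonneg ha.le hk)) i
    rw [hUx] at this
    exact nonneg_of_mul_nonneg_right (neg_nonpos.1 this) ha
  rw [← mulVec_injective_iff_isUnit]
  refine (injective_iff_map_eq_zero
    (U + a • (1 : Matrix (Fin n) (Fin n) ℝ)).mulVecLin).2 fun x hx => ?_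
  rw [mulVecLin_apply] at hx
  funext i
  have h₁ := nonneg_of_ker x hx i
  have h₂ := nonneg_of_ker (-x) (by rw [mulVec_neg, hx, neg_zero]) i
  exact le_antisymm (neg_nonneg.1 h₂) h₁

theorem rightInverse_mulVec_nonneg (h : SatisfiesCMP U) (hUM : U * M = 1) {y : Fin n → ℝ}
    {j : Fin n} (hj : 1 < y j) (hy : ∀ i, i ≠ j → y i ≤ 1) : 0 ≤ M.mulVec y j := by
  by_contra! hneg
  have hU : U.mulVec (M.mulVec y) = y := by rw [mulVec_mulVec, hUM, one_mulVec]
  have := h (M.mulVec y) (fun i hi => ?_) j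
  · rw [hU] at this
    exact this.not_gt hj
  · rw [hU]
    refine hy i ?_
    rintro rfl
    exact hi.not_gt hneg

theorem rightInverse_rowSum_nonneg (h : SatisfiesCMP U) (hUM : U * M = 1) (i : Fin n) :
    0 ≤ ∑ j, M i j := by
  have rowSum : M.mulVec 1 i = ∑ j, M i j := by simp [mulVec, dotProduct]
  have key : ∀ δ : ℝ, 0 < δ → 0 ≤ ∑ j, M i j + δ * M i i := by
    intro δ hδ
    have := h.rightInverse_mulVec_nonneg hUM (y := 1 + Pi.single i δ) (j := i) (by simpa)
      (fun k hk => by simp [hk])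
    rw [mulVec_add, Pi.add_apply, mulVec_single, rowSum] at this
    simpa [mul_comm] using this
  have lim : Filter.Tendsto (fun δ : ℝ => ∑ j, M i j + δ * M i i) (nhdsWithin 0 (Set.Ioi 0))
      (nhds (∑ j, M i j + 0 * M i i)) :=
    (Continuous.tendsto (by fun_prop) 0).mono_left nhdsWithin_le_nhds
  simpa using ge_of_tendsto lim (Filter.eventually_of_mem self_mem_nhdsWithin key)

theorem rightInverse_offDiag_nonpos (h : SatisfiesCMP U) (hUM : U * M = 1) {i j : Fin n}
    (hij : i ≠ j) : M i j ≤ 0 := by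
  have key : ∀ δ : ℝ, 0 ≤ δ → 0 ≤ 2 * M i i - δ * M i j := by
    intro δ hδ
    have := h.rightInverse_mulVec_nonneg hUM (y := Pi.single i 2 - Pi.single j δ) (j := i)
      (by simp [hij]) (fun k hk => ?_)
    · rw [mulVec_sub, Pi.sub_apply, mulVec_single, mulVec_single] at this
      simpa [mul_comm] using this
    · by_cases hkj : k = j
      · subst hkj
        simp [hk]
        linarith
      · simp [hk, hkj]
  by_contra! hpos
  have h₀ := key 0 le_rfl
  have h₁ := key ((2 * M i i + 1) / M i j) (div_nonneg (by linarith) hpos.le)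
  rw [div_mul_cancel₀ _ hpos.ne'] at h₁
  linarith

end SatisfiesCMP

/-- The inequality `⟨(y - 𝟙)⁺, M y⟩ ≥ 0` for a row and column diagonally dominant `M`-matrix. -/
theorem sum_posPart_mul_mulVec_nonneg {ι : Type*} [Fintype ι] {M : Matrix ι ι ℝ}
    (hoff : ∀ i j, i ≠ j → M i j ≤ 0) (hrow : ∀ i, 0 ≤ ∑ j, M i j)
    (hcol : ∀ j, 0 ≤ ∑ i, M i j) (y : ι → ℝ) :
    0 ≤ ∑ i, max (y i - 1) 0 * M.mulVec y i := by
  set z : ι → ℝ := fun i => max (y i - 1) 0 with hz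
  have hz0 : ∀ i, 0 ≤ z i := fun i => le_max_right _ _
  have hzy : ∀ i, y i ≤ z i + 1 := fun i => by linarith [le_max_left (y i - 1) 0]
  have hzz : ∀ i, z i * y i = z i * (z i + 1) := by
    intro i
    rcases max_choice (y i - 1) 0 with h | h
    · simp only [hz, h]; ring
    · simp only [hz, h]; ring
  have term : ∀ i j, M i j * (z i + z i ^ 2 / 2) + M i j * (z j ^ 2 / 2) ≤
      z i * (M i j * y j) := by
    intro i j
    by_cases hij : i = j
    · subst hij
      have : z i * (M i i * y i) = M i i * (z i * (z i + 1)) := by rw [← hzz]; ring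
      rw [this]
      exact le_of_eq (by ring)
    · have h₁ : z i * y j ≤ z i + z i ^ 2 / 2 + z j ^ 2 / 2 := by
        linarith [mul_le_mul_of_nonneg_left (hzy j) (hz0 i), sq_nonneg (z i - z j)]
      linarith [mul_le_mul_of_nonpos_left h₁ (hoff i j hij)]
  calc 0 ≤ ∑ i, (∑ j, M i j) * (z i + z i ^ 2 / 2) + ∑ j, (∑ i, M i j) * (z j ^ 2 / 2) :=
        add_nonneg
          (sum_nonneg fun i _ => mul_nonneg (hrow i) (add_nonneg (hz0 i) (by positivity)))
          (sum_nonneg fun j _ => mul_nonneg (hcol j) (by positivity))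
    _ = ∑ i, ∑ j, (M i j * (z i + z i ^ 2 / 2) + M i j * (z j ^ 2 / 2)) := by
        simp only [sum_mul, sum_add_distrib]
        rw [sum_comm (f := fun j i => M i j * (z j ^ 2 / 2))]
    _ ≤ ∑ i, ∑ j, z i * (M i j * y j) := sum_le_sum fun i _ => sum_le_sum fun j _ => term i j
    _ = ∑ i, z i * M.mulVec y i := by simp only [mulVec, dotProduct, mul_sum]

theorem SatisfiesCMP.sum_posPart_mul_nonneg_of_isUnit {n : ℕ} {U : Matrix (Fin n) (Fin n) ℝ}
    (h : SatisfiesCMP U) (hT : SatisfiesCMP Uᵀ) (hU : IsUnit U) (x : Fin n → ℝ) :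
    0 ≤ ∑ i, max (U.mulVec x i - 1) 0 * x i := by
  have hdet : IsUnit U.det := (isUnit_iff_isUnit_det U).1 hU
  have hUM : U * U⁻¹ = 1 := mul_nonsing_inv U hdet
  have hMU : U⁻¹ * U = 1 := nonsing_inv_mul U hdet
  have hUMT : Uᵀ * U⁻¹ᵀ = 1 := by rw [← transpose_mul, hMU, transpose_one]
  have := sum_posPart_mul_mulVec_nonneg (M := U⁻¹)
    (fun i j hij => h.rightInverse_offDiag_nonpos hUM hij)
    (h.rightInverse_rowSum_nonneg hUM)
    (hT.rightInverse_rowSum_nonneg hUMT) (U.mulVec x)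
  rwa [mulVec_mulVec, hMU, one_mulVec] at this

/-- If a nonnegative matrix `U` (possibly singular) and its transpose
both satisfy the CMP, then `⟨(Ux − 𝟙)⁺, x⟩ ≥ 0` for all `x`. -/
theorem stmt_14 {n : ℕ} (U : Matrix (Fin n) (Fin n) ℝ)
    (hU : ∀ i j, 0 ≤ U i j)
    (hcmp : SatisfiesCMP U) (hcmpT : SatisfiesCMP Uᵀ) :
    ∀ x : Fin n → ℝ, 0 ≤ ∑ i, max (U.mulVec x i - 1) 0 * x i := by
  intro x
  have key : ∀ ε : ℝ, 0 < ε → 0 ≤ ∑ i, max (U.mulVec x i + ε * x i - 1) 0 * x i := by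
    intro ε hε
    have hT := hcmpT.add_smul_one hε.le
    have := (hcmp.add_smul_one hε.le).sum_posPart_mul_nonneg_of_isUnit
      (by simpa using hT) (hcmp.isUnit_add_smul_one hε) x
    simpa only [add_mulVec, smul_mulVec, one_mulVec, Pi.add_apply, Pi.smul_apply,
      smul_eq_mul] using this
  have lim : Filter.Tendsto (fun ε : ℝ => ∑ i, max (U.mulVec x i + ε * x i - 1) 0 * x i)
      (nhdsWithin 0 (Set.Ioi 0)) (nhds (∑ i, max (U.mulVec x i + 0 * x i - 1) 0 * x i)) :=
    (Continuous.tendsto (by fun_prop) 0).mono_left nhdsWithin_le_nhds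
  simpa using ge_of_tendsto lim (Filter.eventually_of_mem self_mem_nhdsWithin key)
end

section
/- Let U be a nonnegative nonsingular real n×n matrix such that both U and its transpose Uᵗ are potential matrices. Then U⁻¹ can be written as U⁻¹ = k(I − P) for some constant k > 0 and some doubly substochastic nonnegative matrix P (i.e. P ≥ 0 with Σ_j P_{ij} ≤ 1 and Σ_j P_{ji} ≤ 1 for all i). -/
open Matrix Finset

/-- A nonnegative nonsingular matrix `U` is a potential if `M = U⁻¹` satisfies
`M i j ≤ 0` for `i ≠ j`, `M i i > 0`, and row diagonal dominance. -/
def IsPotential {n : ℕ} (U : Matrix (Fin n) (Fin n) ℝ) : Prop :=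
  (∀ i j, 0 ≤ U i j) ∧ IsUnit U.det ∧
    (∀ i j, i ≠ j → U⁻¹ i j ≤ 0) ∧ (∀ i, 0 < U⁻¹ i i) ∧
    (∀ i, ∑ j ∈ Finset.univ.erase i, |U⁻¹ i j| ≤ U⁻¹ i i)

theorem IsPotential.row_sum_inv_nonneg {n : ℕ} {U : Matrix (Fin n) (Fin n) ℝ}
    (h : IsPotential U) (i : Fin n) : 0 ≤ ∑ j, U⁻¹ i j := by
  obtain ⟨-, -, -, -, hdom⟩ := h
  rw [← Finset.add_sum_erase _ _ (Finset.mem_univ i)]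
  have habs := Finset.abs_sum_le_sum_abs (fun j => U⁻¹ i j) (Finset.univ.erase i)
  linarith [hdom i, neg_abs_le (∑ j ∈ Finset.univ.erase i, U⁻¹ i j)]

/-- If `U` and `Uᵀ` are potentials, then `U⁻¹ = k(I − P)` for some
`k > 0` and some doubly substochastic nonnegative matrix `P`. -/
theorem stmt_19 {n : ℕ} (U : Matrix (Fin n) (Fin n) ℝ)
    (hU : ∀ i j, 0 ≤ U i j) (hns : IsUnit U.det)
    (hpot : IsPotential U) (hpotT : IsPotential Uᵀ) :
    ∃ k : ℝ, 0 < k ∧ ∃ P : Matrix (Fin n) (Fin n) ℝ,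
      (∀ i j, 0 ≤ P i j) ∧ (∀ i, ∑ j, P i j ≤ 1) ∧ (∀ i, ∑ j, P j i ≤ 1) ∧
      U⁻¹ = k • ((1 : Matrix (Fin n) (Fin n) ℝ) - P) := by
  have hrow := hpot.row_sum_inv_nonneg
  obtain ⟨-, -, hoff, hdiag, -⟩ := hpot
  set M := U⁻¹
  have hcol : ∀ i, 0 ≤ ∑ j, M j i := fun i => by
    simpa [← Matrix.transpose_nonsing_inv] using hpotT.row_sum_inv_nonneg i
  have htr : 0 ≤ ∑ i, M i i := Finset.sum_nonneg fun i _ => (hdiag i).le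
  have hk : 0 < 1 + ∑ i, M i i := by linarith
  have hle : ∀ i, M i i ≤ 1 + ∑ i, M i i := fun i => by
    linarith [Finset.single_le_sum (fun j _ => (hdiag j).le) (Finset.mem_univ i)]
  set k := 1 + ∑ i, M i i
  refine ⟨k, hk, 1 - k⁻¹ • M, fun i j => ?_, fun i => ?_, fun i => ?_, ?_⟩
  · rcases eq_or_ne i j with rfl | hij
    · simpa [inv_mul_le_iff₀ hk] using hle i
    · simpa [hij] using mul_nonpos_of_nonneg_of_nonpos (inv_pos.2 hk).le (hoff i j hij)
  · have := mul_nonneg (inv_pos.2 hk).le (hrow i)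
    simpa [Matrix.one_apply, ← Finset.mul_sum] using this
  · have := mul_nonneg (inv_pos.2 hk).le (hcol i)
    simpa [Matrix.one_apply, ← Finset.mul_sum] using this
  · simp [smul_smul, hk.ne']
end
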